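/- arXiv:1610.01527 — 7 statements merged into one kernel-verified Lean document; each statement's English description precedes it below -/
import Mathlib

section
/- Let X be a metric space such that for every x ∈ X there exists ε > 0 for which the closure of the open ball B(x,ε) is a complete subset of X, and such that for every x ∈ X the set {ε > 0 : the closure of B(x,ε) is complete} is bounded above. Define r : X → ℝ by r(x) = sup{ε > 0 : the closure of B(x,ε) is a complete subset of X}. Then |r(p) − r(q)| ≤ dist(p,q) for all p, q ∈ X; in particular r is continuous. -/
theorem IsComplete.of_isClosed_of_subset {X : Type*} [UniformSpace X] {s t : Set X}
    (ht : IsComplete t) (hs : IsClosed s) (hst : s ⊆ t) : IsComplete s := by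
  intro f hf hfs
  obtain ⟨x, -, hx⟩ := ht f hf (hfs.trans (Filter.principal_mono.2 hst))
  have : f.NeBot := hf.1
  exact ⟨x, hs.mem_of_tendsto hx (Filter.le_principal_iff.1 hfs), hx⟩

theorem sSup_complete_closure_ball_le_add_dist {X : Type*} [PseudoMetricSpace X] (p q : X)
    (hne : ∃ ε : ℝ, 0 < ε ∧ IsComplete (closure (Metric.ball p ε)))
    (hbdd : BddAbove {ε : ℝ | 0 < ε ∧ IsComplete (closure (Metric.ball q ε))}) :
    sSup {ε : ℝ | 0 < ε ∧ IsComplete (closure (Metric.ball p ε))} ≤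
      sSup {ε : ℝ | 0 < ε ∧ IsComplete (closure (Metric.ball q ε))} + dist p q := by
  refine csSup_le hne fun ε hε => ?_
  rcases le_or_gt ε (dist p q) with h | h
  · exact h.trans (le_add_of_nonneg_left (Real.sSup_nonneg fun δ hδ => hδ.1.le))
  · refine sub_le_iff_le_add.1 (le_csSup hbdd ⟨sub_pos.2 h, ?_⟩)
    refine hε.2.of_isClosed_of_subset isClosed_closure (closure_mono ?_)
    exact Metric.ball_subset_ball' (by rw [dist_comm q p, sub_add_cancel])

/-- The "completeness radius" `r x = sup {ε > 0 : closure (B(x, ε)) is complete}` is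
1-Lipschitz (hence continuous), provided it is well-defined (the defining set is
nonempty and bounded above at every point). -/
theorem completenessRadius_lipschitz
    {X : Type*} [MetricSpace X]
    (hne : ∀ x : X, ∃ ε : ℝ, 0 < ε ∧ IsComplete (closure (Metric.ball x ε)))
    (hbdd : ∀ x : X,
      BddAbove {ε : ℝ | 0 < ε ∧ IsComplete (closure (Metric.ball x ε))})
    (r : X → ℝ)
    (hr : ∀ x : X,
      r x = sSup {ε : ℝ | 0 < ε ∧ IsComplete (closure (Metric.ball x ε))}) :
    (∀ p q : X, |r p - r q| ≤ dist p q) ∧ Continuous r := by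
  have hle : ∀ p q : X, r p ≤ r q + dist p q := fun p q => by
    rw [hr p, hr q]
    exact sSup_complete_closure_ball_le_add_dist p q (hne p) (hbdd q)
  refine ⟨fun p q => abs_sub_le_iff.2 ⟨?_, ?_⟩, (LipschitzWith.of_le_add hle).continuous⟩
  · exact sub_le_iff_le_add'.2 (hle p q)
  · exact sub_le_iff_le_add'.2 (dist_comm p q ▸ hle q p)
end

section
/- Let X be a metric space whose isometry group acts transitively, i.e., for all x, y ∈ X there exists a bijective isometry f : X → X with f(x) = y. If there exist a point p ∈ X and ε > 0 such that the closure of the open ball B(p,ε) is a complete subset of X, then X is a complete metric space. -/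
/-- If the isometry group of a metric space `X` acts transitively and some point has a
ball whose closure is a complete subset, then `X` is a complete metric space
(homogeneity implies completeness). -/
theorem completeSpace_of_transitive_isometry
    {X : Type*} [MetricSpace X]
    (htrans : ∀ x y : X, ∃ f : X ≃ᵢ X, f x = y)
    (hball : ∃ (p : X) (ε : ℝ), 0 < ε ∧ IsComplete (closure (Metric.ball p ε))) :
    CompleteSpace X := by
  obtain ⟨p, ε, hε, hcomplete⟩ := hball
  refine Metric.complete_of_cauchySeq_tendsto fun u hu => ?_
  obtain ⟨N, hN⟩ := Metric.cauchySeq_iff'.1 hu ε hε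
  obtain ⟨f, hf⟩ := htrans (u N) p
  have hmem (n : ℕ) : f (u (n + N)) ∈ closure (Metric.ball p ε) := by
    apply subset_closure
    rw [Metric.mem_ball, ← hf, f.dist_eq]
    exact hN _ (Nat.le_add_left N n)
  have hcauchy : CauchySeq fun n => f (u (n + N)) :=
    (hu.comp_tendsto (Filter.tendsto_add_atTop_nat N)).map f.isometry.uniformContinuous
  obtain ⟨a, -, ha⟩ := cauchySeq_tendsto_of_isComplete hcomplete hmem hcauchy
  refine ⟨f.symm a, (Filter.tendsto_add_atTop_iff_nat N).1 ?_⟩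
  simpa [Function.comp_def] using (f.symm.continuous.tendsto a).comp ha
end

section
/- Let D : ℓ²(ℕ,ℝ) → ℓ²(ℕ,ℝ) be the continuous linear operator defined coordinatewise by (Dx)ₙ = sin(π/(n+3))·xₙ. Then D is injective and has dense range, but the element y ∈ ℓ²(ℕ,ℝ) given by yₙ = 1/(n+3) does not belong to the range of D; in particular D is not surjective and the range of D is not closed. -/
open Real

/-- A diagonal operator on `ℓ²` with non-vanishing coefficients is injective. -/
theorem injective_of_diagonal {s : ℕ → ℝ} (hs : ∀ n, s n ≠ 0)
    {D : lp (fun _ : ℕ => ℝ) 2 → lp (fun _ : ℕ => ℝ) 2}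
    (hD : ∀ x n, (D x : ∀ _ : ℕ, ℝ) n = s n * (x : ∀ _ : ℕ, ℝ) n) :
    Function.Injective D := by
  intro x z hxz
  ext n
  apply mul_left_cancel₀ (hs n)
  rw [← hD, ← hD, hxz]

/-- A diagonal operator on `ℓ²` with non-vanishing coefficients has dense range. -/
theorem denseRange_of_diagonal {s : ℕ → ℝ} (hs : ∀ n, s n ≠ 0)
    {D : lp (fun _ : ℕ => ℝ) 2 →L[ℝ] lp (fun _ : ℕ => ℝ) 2}
    (hD : ∀ x n, (D x : ∀ _ : ℕ, ℝ) n = s n * (x : ∀ _ : ℕ, ℝ) n) :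
    DenseRange D := by
  have hsingle (i : ℕ) (a : ℝ) :
      D (lp.single 2 i (a / s i)) = lp.single (E := fun _ : ℕ => ℝ) 2 i a := by
    ext n
    rw [hD]
    rcases eq_or_ne n i with rfl | hn
    · simp [mul_div_cancel₀ _ (hs n)]
    · simp [hn]
  intro x
  refine mem_closure_of_tendsto (lp.hasSum_single (by norm_num) x) (.of_forall fun t => ?_)
  exact ⟨∑ i ∈ t, lp.single 2 i (x i / s i), by simp only [map_sum, hsingle]⟩

/-- The coordinates of an element of `ℓ²` tend to zero. -/
theorem tendsto_coord_lp_two (x : lp (fun _ : ℕ => ℝ) 2) :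
    Filter.Tendsto (fun n => (x : ∀ _ : ℕ, ℝ) n) Filter.atTop (nhds 0) := by
  have h := ((lp.memℓp x).summable (by norm_num)).tendsto_atTop_zero
  simp only [ENNReal.toReal_ofNat, Real.rpow_ofNat] at h
  rw [tendsto_zero_iff_abs_tendsto_zero]
  simpa [Function.comp_def, Real.sqrt_sq_eq_abs] using h.sqrt

theorem sin_pi_div_add_three_pos (n : ℕ) : 0 < Real.sin (π / ((n : ℝ) + 3)) := by
  apply Real.sin_pos_of_pos_of_lt_pi (by positivity)
  exact div_lt_self Real.pi_pos (by linarith [n.cast_nonneg (α := ℝ)])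

/-- Grossman's example: the operator `D` on `ℓ²(ℕ, ℝ)` given coordinatewise by
`(D x)ₙ = sin (π / (n + 3)) * xₙ` is injective with dense range, but the square-summable
sequence `yₙ = 1 / (n + 3)` is not in its range; in particular `D` is not surjective and
its range is not closed. -/
theorem grossman_strictly_epiconjugate_operator
    (D : lp (fun _ : ℕ => ℝ) 2 →L[ℝ] lp (fun _ : ℕ => ℝ) 2)
    (hD : ∀ (x : lp (fun _ : ℕ => ℝ) 2) (n : ℕ),
      (D x : ∀ _ : ℕ, ℝ) n = Real.sin (π / ((n : ℝ) + 3)) * (x : ∀ _ : ℕ, ℝ) n)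
    (y : lp (fun _ : ℕ => ℝ) 2)
    (hy : ∀ n : ℕ, (y : ∀ _ : ℕ, ℝ) n = 1 / ((n : ℝ) + 3)) :
    Function.Injective D ∧ DenseRange D ∧ y ∉ Set.range D ∧
      ¬ Function.Surjective D ∧ ¬ IsClosed (Set.range D) := by
  have hs (n : ℕ) := (sin_pi_div_add_three_pos n).ne'
  have hdense : DenseRange D := denseRange_of_diagonal hs hD
  have hyD : y ∉ Set.range D := by
    rintro ⟨x, rfl⟩
    have hx (n : ℕ) : 1 / π ≤ (x : ∀ _ : ℕ, ℝ) n := by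
      have hpos := sin_pi_div_add_three_pos n
      have hle : Real.sin (π / ((n : ℝ) + 3)) ≤ π / ((n : ℝ) + 3) :=
        Real.sin_le (by positivity)
      have heq := hy n
      rw [hD] at heq
      refine le_of_mul_le_mul_left ?_ hpos
      rw [heq, mul_one_div, div_le_iff₀ Real.pi_pos]
      rwa [one_div_mul_eq_div]
    have := ge_of_tendsto' (tendsto_coord_lp_two x) hx
    exact this.not_gt (one_div_pos.mpr Real.pi_pos)
  refine ⟨injective_of_diagonal hs hD, hdense, hyD, fun h => hyD (h y), fun h => hyD ?_⟩
  rw [← h.closure_eq]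
  exact hdense y
end

section
/- Let H be a real Hilbert space, let R : ℝ → L(H) be a continuous map into the bounded linear operators on H such that R(s) is a compact operator for every s, and let T : ℝ → L(H) be a continuous map satisfying the integral equation T(t) = t·Id − ∫₀ᵗ ( ∫₀ʰ R(s) ∘ T(s) ds ) dh for all t ∈ ℝ, where the integrals are Bochner integrals in the operator norm. Then T(t) − t·Id is a compact operator for every t ∈ ℝ. -/
open MeasureTheory

theorem Submodule.intervalIntegral_mem_of_isClosed {E : Type*} [NormedAddCommGroup E]
    [NormedSpace ℝ E] [CompleteSpace E] {S : Submodule ℝ E} (hS : IsClosed (S : Set E))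
    {f : ℝ → E} (hf : ∀ x, f x ∈ S) (μ : Measure ℝ) (a b : ℝ) : ∫ x in a..b, f x ∂μ ∈ S := by
  have : CompleteSpace S := hS.completeSpace_coe
  have key (ν : Measure ℝ) : ∫ x, f x ∂ν ∈ S := by
    have h := S.subtypeₗᵢ.integral_comp_comm (μ := ν) (fun x ↦ (⟨f x, hf x⟩ : S))
    simp only [Submodule.coe_subtypeₗᵢ, Submodule.subtype_apply] at h
    exact h ▸ Submodule.coe_mem _
  exact S.sub_mem (key _) (key _)

/-- If the curvature operators `R s` are compact and the Jacobi flow `T` satisfies the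
integral equation `T t = t • Id - ∫₀ᵗ ∫₀ʰ R s ∘ T s ds dh`, then `T t - t • Id` is a
compact operator for every `t`. -/
theorem jacobiFlow_sub_id_isCompactOperator
    {H : Type*} [NormedAddCommGroup H] [InnerProductSpace ℝ H] [CompleteSpace H]
    (R T : ℝ → H →L[ℝ] H)
    (hRcont : Continuous R) (hTcont : Continuous T)
    (hRcompact : ∀ s : ℝ, IsCompactOperator (R s))
    (hInt : ∀ t : ℝ,
      T t = t • (1 : H →L[ℝ] H)
        - ∫ h in (0:ℝ)..t, (∫ s in (0:ℝ)..h, (R s).comp (T s))) :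
    ∀ t : ℝ, IsCompactOperator (T t - t • (1 : H →L[ℝ] H)) := by
  intro t
  have hclosed : IsClosed (compactOperator (RingHom.id ℝ) H H : Set (H →L[ℝ] H)) :=
    isClosed_setOfPred_isCompactOperator
  have hmem : ∫ h in (0:ℝ)..t, (∫ s in (0:ℝ)..h, (R s).comp (T s)) ∈
      compactOperator (RingHom.id ℝ) H H :=
    Submodule.intervalIntegral_mem_of_isClosed hclosed
      (fun h ↦ Submodule.intervalIntegral_mem_of_isClosed hclosed
        (fun s ↦ (hRcompact s).comp_clm (T s)) _ _ _) _ _ _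
  have hsub : T t - t • (1 : H →L[ℝ] H) =
      -∫ h in (0:ℝ)..t, (∫ s in (0:ℝ)..h, (R s).comp (T s)) := by
    nth_rewrite 1 [hInt t]
    abel
  rw [hsub]
  exact Submodule.neg_mem _ hmem
end

section
/- Let H be a real Hilbert space of dimension at least 2 and let x, y ∈ H be unit vectors. Then there exists a continuous path γ : [0,1] → H with ‖γ(t)‖ = 1 for all t, γ(0) = x, γ(1) = y, whose length (total variation) equals arccos⟨x,y⟩. Consequently the intrinsic distance on the unit sphere between x and y equals arccos⟨x,y⟩ and is attained by a path. -/
open scoped RealInnerProductSpace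

open InnerProductGeometry in
/-- The chord between two unit vectors bounds their angle up to a cubic error. -/
theorem angle_le_norm_sub_mul_one_add_sq {E : Type*} [NormedAddCommGroup E]
    [InnerProductSpace ℝ E] {x y : E} (hx : ‖x‖ = 1) (hy : ‖y‖ = 1) :
    angle x y ≤ (1 + ‖x - y‖ ^ 2) * ‖x - y‖ := by
  set u := angle x y / 2 with hu
  have hu0 : 0 ≤ u := by have := angle_nonneg x y; positivity
  have huπ : u ≤ Real.pi / 2 := by have := angle_le_pi x y; linarith
  have hsin : 0 ≤ Real.sin u := Real.sin_nonneg_of_nonneg_of_le_pi hu0 (by linarith)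
  have hchord : ‖x - y‖ = 2 * Real.sin u := by
    refine (sq_eq_sq₀ (norm_nonneg _) (by positivity)).mp ?_
    have hcos : ⟪x, y⟫ = 1 - 2 * Real.sin u ^ 2 := by
      have h1 := Real.cos_two_mul u
      have h2 := Real.sin_sq_add_cos_sq u
      have h3 : ⟪x, y⟫ = Real.cos (2 * u) := by
        rw [hu, mul_div_cancel₀ _ two_ne_zero, cos_angle, hx, hy]; simp
      linarith
    rw [norm_sub_sq_real, hx, hy, hcos]; ring
  have hjordan : 2 / Real.pi * u ≤ Real.sin u := Real.mul_le_sin hu0 huπ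
  have hu2 : u ≤ 2 * Real.sin u := by
    have : 1 / 2 ≤ 2 / Real.pi := by
      rw [div_le_div_iff₀ two_pos Real.pi_pos]; linarith [Real.pi_le_four]
    nlinarith
  have hcube : u - u ^ 3 / 6 ≤ Real.sin u := by
    rcases hu0.eq_or_lt with h0 | h0
    · simp [← h0]
    · exact (Real.sin_gt_sub_cube h0).le
  have hc3 : u ^ 3 ≤ (2 * Real.sin u) ^ 3 := by gcongr
  rw [hchord]
  have : angle x y = 2 * u := by rw [hu]; ring
  nlinarith [pow_nonneg hsin 3]

open InnerProductGeometry in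
/-- The angle between the endpoints of a continuous path on the unit sphere is at most the
length of the path. -/
theorem ofReal_angle_le_eVariationOn {E : Type*} [NormedAddCommGroup E]
    [InnerProductSpace ℝ E] {γ : ℝ → E} (hγ : ContinuousOn γ (Set.Icc 0 1))
    (hnorm : ∀ t ∈ Set.Icc (0 : ℝ) 1, ‖γ t‖ = 1) :
    ENNReal.ofReal (angle (γ 0) (γ 1)) ≤ eVariationOn γ (Set.Icc 0 1) := by
  rcases eq_or_ne (eVariationOn γ (Set.Icc 0 1)) ⊤ with htop | htop
  · simp [htop]
  rw [ENNReal.ofReal_le_iff_le_toReal htop]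
  set V := (eVariationOn γ (Set.Icc 0 1)).toReal with hV
  have hV0 : 0 ≤ V := ENNReal.toReal_nonneg
  have key : ∀ ε : ℝ, 0 < ε → ε < 1 → angle (γ 0) (γ 1) ≤ (1 + ε) * V := by
    intro ε hε hε1
    obtain ⟨δ, hδ, hδγ⟩ := Metric.uniformContinuousOn_iff.mp
      (isCompact_Icc.uniformContinuousOn_of_continuous hγ) ε hε
    obtain ⟨n, hn⟩ := exists_nat_one_div_lt hδ
    have hn0 : (0 : ℝ) < n + 1 := by positivity
    let u : ℕ → ℝ := fun i => i / (n + 1)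
    have hu : Monotone u := fun i j hij => by
      simp only [u]; gcongr
    have hmem : ∀ i ≤ n + 1, u i ∈ Set.Icc (0 : ℝ) 1 := fun i hi => by
      refine ⟨by positivity, ?_⟩
      rw [div_le_one hn0]; exact_mod_cast hi
    have hsum : ∀ m ≤ n + 1, angle (γ (u 0)) (γ (u m)) ≤
        (1 + ε) * ∑ i ∈ Finset.range m, dist (γ (u (i + 1))) (γ (u i)) := by
      intro m
      induction m with
      | zero =>
        intro _
        have : γ (u 0) ≠ 0 := by
          rw [← norm_ne_zero_iff, hnorm _ (hmem 0 (by omega))]; exact one_ne_zero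
        simp [angle_self this]
      | succ m ih =>
        intro hm
        have hm1 := hmem (m + 1) hm
        have hm0 := hmem m (by omega)
        have hd : dist (u (m + 1)) (u m) < δ := by
          have : u (m + 1) - u m = 1 / (n + 1) := by
            simp only [u]; push_cast; ring
          rw [Real.dist_eq, this, abs_of_pos (by positivity)]; exact hn
        have hc := hδγ _ hm1 _ hm0 hd
        have hc0 : 0 ≤ dist (γ (u (m + 1))) (γ (u m)) := dist_nonneg
        have hstep : angle (γ (u (m + 1))) (γ (u m)) ≤
            (1 + ε) * dist (γ (u (m + 1))) (γ (u m)) := by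
          rw [dist_eq_norm] at hc hc0 ⊢
          refine (angle_le_norm_sub_mul_one_add_sq (hnorm _ hm1) (hnorm _ hm0)).trans ?_
          gcongr
          nlinarith
        rw [angle_comm] at hstep
        rw [Finset.sum_range_succ, mul_add]
        linarith [angle_le_angle_add_angle (γ (u 0)) (γ (u m)) (γ (u (m + 1))),
          ih (by omega)]
    have hVsum : ∑ i ∈ Finset.range (n + 1), dist (γ (u (i + 1))) (γ (u i)) ≤ V := by
      rw [hV, ← ENNReal.ofReal_le_iff_le_toReal htop,
        ENNReal.ofReal_sum_of_nonneg fun _ _ => dist_nonneg]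
      simp_rw [← edist_dist]
      exact eVariationOn.sum_le_of_monotoneOn_Iic (hu.monotoneOn _) fun i hi => hmem i hi
    have h0 : u 0 = 0 := by simp [u]
    have h1 : u (n + 1) = 1 := by
      simp only [u]; push_cast; exact div_self hn0.ne'
    have := hsum (n + 1) le_rfl
    rw [h0, h1] at this
    exact this.trans (by gcongr)
  refine le_of_forall_pos_lt_add fun ε hε => ?_
  have hη : 0 < min (1 / 2) (ε / (2 * (V + 1))) := by positivity
  have h1 := key _ hη (lt_of_le_of_lt (min_le_left _ _) (by norm_num))
  have h2 : min (1 / 2) (ε / (2 * (V + 1))) * (V + 1) ≤ ε / 2 := by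
    calc _ ≤ ε / (2 * (V + 1)) * (V + 1) := by gcongr; exact min_le_right _ _
      _ = ε / 2 := by field_simp
  nlinarith

/-- In dimension at least two, every vector has a unit vector orthogonal to it. -/
theorem exists_norm_eq_one_inner_eq_zero {E : Type*} [NormedAddCommGroup E]
    [InnerProductSpace ℝ E] (hdim : 2 ≤ Module.rank ℝ E) (x : E) :
    ∃ v : E, ‖v‖ = 1 ∧ ⟪x, v⟫ = 0 := by
  have hne : (ℝ ∙ x)ᗮ ≠ ⊥ := by
    intro h
    rw [Submodule.orthogonal_eq_bot_iff] at h
    have h1 : Module.rank ℝ (ℝ ∙ x) ≤ 1 := by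
      simpa using rank_span_le (R := ℝ) ({x} : Set E)
    rw [h, rank_top] at h1
    exact absurd (hdim.trans h1) (by norm_num)
  obtain ⟨w, hw, hw0⟩ := Submodule.exists_mem_ne_zero_of_ne_bot hne
  rw [Submodule.mem_orthogonal_singleton_iff_inner_right] at hw
  exact ⟨‖w‖⁻¹ • w, norm_smul_inv_norm hw0, by rw [inner_smul_right, hw, mul_zero]⟩

/-- Unit vectors `x, y` span a great circle, on which `y` lies at arc length `arccos ⟪x, y⟫`
from `x`. -/
theorem exists_eq_cos_arccos_smul_add_sin_arccos_smul {E : Type*} [NormedAddCommGroup E]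
    [InnerProductSpace ℝ E] (hdim : 2 ≤ Module.rank ℝ E) {x y : E}
    (hx : ‖x‖ = 1) (hy : ‖y‖ = 1) :
    ∃ v : E, ‖v‖ = 1 ∧ ⟪x, v⟫ = 0 ∧
      y = Real.cos (Real.arccos ⟪x, y⟫) • x + Real.sin (Real.arccos ⟪x, y⟫) • v := by
  have habs : |⟪x, y⟫| ≤ 1 := by simpa [hx, hy] using abs_real_inner_le_norm x y
  rw [Real.cos_arccos (abs_le.mp habs).1 (abs_le.mp habs).2, Real.sin_arccos]
  set w := y - ⟪x, y⟫ • x with hw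
  have hyw : y = ⟪x, y⟫ • x + w := by rw [hw]; abel
  have hxw : ⟪x, w⟫ = 0 := by
    rw [hw, inner_sub_right, inner_smul_right, real_inner_self_eq_norm_sq, hx]; ring
  have hnorm : ‖w‖ = √(1 - ⟪x, y⟫ ^ 2) := by
    rw [← Real.sqrt_sq (norm_nonneg w), hw, norm_sub_sq_real, inner_smul_right, norm_smul,
      real_inner_comm, hx, hy, Real.norm_eq_abs, mul_one, sq_abs]
    ring_nf
  rw [← hnorm]
  rcases eq_or_ne w 0 with h0 | h0
  · obtain ⟨v, hv, hxv⟩ := exists_norm_eq_one_inner_eq_zero hdim x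
    refine ⟨v, hv, hxv, ?_⟩
    rw [h0, norm_zero, zero_smul, ← h0]
    exact hyw
  · refine ⟨‖w‖⁻¹ • w, norm_smul_inv_norm h0, by rw [inner_smul_right, hxw, mul_zero], ?_⟩
    rw [smul_inv_smul₀ (norm_ne_zero_iff.mpr h0)]
    exact hyw

/-- Two points of a unit-speed great circle are no further apart than their parameters. -/
theorem dist_cos_smul_add_sin_smul_le {E : Type*} [NormedAddCommGroup E]
    [InnerProductSpace ℝ E] {x v : E} (hx : ‖x‖ = 1) (hv : ‖v‖ = 1) (hxv : ⟪x, v⟫ = 0)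
    (s t : ℝ) :
    dist (Real.cos s • x + Real.sin s • v) (Real.cos t • x + Real.sin t • v) ≤ |s - t| := by
  refine abs_le_of_sq_le_sq' ?_ (abs_nonneg _) |>.2
  have : Real.cos s • x + Real.sin s • v - (Real.cos t • x + Real.sin t • v) =
      (Real.cos s - Real.cos t) • x + (Real.sin s - Real.sin t) • v := by module
  rw [dist_eq_norm, this, norm_add_sq_real, inner_smul_left, inner_smul_right, hxv, norm_smul,
    norm_smul, hx, hv, mul_one, mul_one, Real.norm_eq_abs, Real.norm_eq_abs, sq_abs, sq_abs,
    sq_abs]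
  have h1 := Real.one_sub_sq_div_two_le_cos (x := s - t)
  rw [Real.cos_sub] at h1
  nlinarith [Real.sin_sq_add_cos_sq s, Real.sin_sq_add_cos_sq t]

/-- On the unit sphere of a real Hilbert space of dimension at least 2, any two unit
vectors `x, y` are joined by a continuous path on the sphere of length exactly
`arccos ⟪x, y⟫`; consequently the intrinsic distance (infimum of lengths of paths on the
sphere joining `x` and `y`) equals `arccos ⟪x, y⟫` and is attained. -/
theorem sphere_hopf_rinow
    {H : Type*} [NormedAddCommGroup H] [InnerProductSpace ℝ H] [CompleteSpace H]
    (hdim : 2 ≤ Module.rank ℝ H)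
    (x y : H) (hx : ‖x‖ = 1) (hy : ‖y‖ = 1) :
    (∃ γ : ℝ → H, ContinuousOn γ (Set.Icc 0 1) ∧
        (∀ t ∈ Set.Icc (0:ℝ) 1, ‖γ t‖ = 1) ∧ γ 0 = x ∧ γ 1 = y ∧
        eVariationOn γ (Set.Icc 0 1) = ENNReal.ofReal (Real.arccos ⟪x, y⟫)) ∧
      sInf {L : ENNReal | ∃ γ : ℝ → H, ContinuousOn γ (Set.Icc 0 1) ∧
          (∀ t ∈ Set.Icc (0:ℝ) 1, ‖γ t‖ = 1) ∧ γ 0 = x ∧ γ 1 = y ∧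
          eVariationOn γ (Set.Icc 0 1) = L}
        = ENNReal.ofReal (Real.arccos ⟪x, y⟫) := by
  have hangle : InnerProductGeometry.angle x y = Real.arccos ⟪x, y⟫ := by
    simp [InnerProductGeometry.angle, hx, hy]
  have hlower : ∀ γ : ℝ → H, ContinuousOn γ (Set.Icc 0 1) →
      (∀ t ∈ Set.Icc (0:ℝ) 1, ‖γ t‖ = 1) → γ 0 = x → γ 1 = y →
      ENNReal.ofReal (Real.arccos ⟪x, y⟫) ≤ eVariationOn γ (Set.Icc 0 1) := by
    intro γ hγ hnorm h0 h1
    rw [← hangle, ← h0, ← h1]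
    exact ofReal_angle_le_eVariationOn hγ hnorm
  have hexists : ∃ γ : ℝ → H, ContinuousOn γ (Set.Icc 0 1) ∧
      (∀ t ∈ Set.Icc (0:ℝ) 1, ‖γ t‖ = 1) ∧ γ 0 = x ∧ γ 1 = y ∧
      eVariationOn γ (Set.Icc 0 1) = ENNReal.ofReal (Real.arccos ⟪x, y⟫) := by
    obtain ⟨v, hv, hxv, hxy⟩ := exists_eq_cos_arccos_smul_add_sin_arccos_smul hdim hx hy
    set θ := Real.arccos ⟪x, y⟫
    have hθ : 0 ≤ θ := Real.arccos_nonneg _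
    let γ : ℝ → H := fun t => Real.cos (θ * t) • x + Real.sin (θ * t) • v
    have hγ : LipschitzWith (Real.toNNReal θ) γ := by
      refine LipschitzWith.of_dist_le_mul fun s t => ?_
      refine (dist_cos_smul_add_sin_smul_le hx hv hxv _ _).trans_eq ?_
      rw [← mul_sub, abs_mul, abs_of_nonneg hθ, Real.coe_toNNReal _ hθ, Real.dist_eq]
    have hnorm : ∀ t, ‖γ t‖ = 1 := fun t => by
      rw [← sq_eq_sq₀ (norm_nonneg _) zero_le_one, norm_add_sq_real, inner_smul_left,
        inner_smul_right, hxv, norm_smul, norm_smul, hx, hv, mul_one, mul_one,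
        Real.norm_eq_abs, Real.norm_eq_abs, sq_abs, sq_abs]
      simp
    have h0 : γ 0 = x := by simp [γ]
    have h1 : γ 1 = y := by simp only [γ, mul_one]; exact hxy.symm
    refine ⟨γ, hγ.continuous.continuousOn, fun t _ => hnorm t, h0, h1, le_antisymm ?_
      (hlower γ hγ.continuous.continuousOn (fun t _ => hnorm t) h0 h1)⟩
    have := (hγ.lipschitzOnWith (s := Set.univ)).comp_eVariationOn_le
      (f := γ) (g := id) (s := Set.Icc (0:ℝ) 1) (Set.mapsTo_univ _ _)
    rw [eVariationOn_id_Icc, sub_zero, ENNReal.ofReal_one, mul_one] at this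
    exact this
  refine ⟨hexists, le_antisymm (sInf_le hexists) (le_sInf ?_)⟩
  rintro L ⟨γ, hγ, hnorm, h0, h1, rfl⟩
  exact hlower γ hγ hnorm h0 h1
end

section
/- Let M = { x ∈ ℓ²(ℕ,ℝ) : x₀² + Σ_{i≥1} (1 − 1/(i+1))²·x_i² = 1 }, let p = e₀ and q = −e₀, where e₀ is the first standard basis vector. Then every continuous path γ : [0,1] → ℓ² with image contained in M, γ(0) = p and γ(1) = q has length (total variation) strictly greater than π, while the infimum of the lengths of such paths equals π. In particular the intrinsic distance between p and q in M is not realized by any path: there is no minimal geodesic joining p and q. -/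
open scoped ENNReal

namespace Grossman

open Set Filter Topology

/-- The reciprocal of the semi-axis of Grossman's ellipsoid in the direction `e_{i+1}`. -/
noncomputable def coeff (i : ℕ) : ℝ := 1 - 1 / ((i : ℝ) + 2)

lemma coeff_pos (i : ℕ) : 0 < coeff i := by
  have h : (0 : ℝ) < (i : ℝ) + 2 := by positivity
  have : 1 / ((i : ℝ) + 2) < 1 := by rw [div_lt_one h]; linarith [(Nat.cast_nonneg i : (0 : ℝ) ≤ i)]
  unfold coeff; linarith

lemma coeff_lt_one (i : ℕ) : coeff i < 1 := by
  have : 0 < 1 / ((i : ℝ) + 2) := by positivity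
  unfold coeff; linarith

lemma coeff_sq_lt_one (i : ℕ) : coeff i ^ 2 < 1 := by
  nlinarith [coeff_pos i, coeff_lt_one i]

lemma tendsto_coeff : Tendsto coeff atTop (𝓝 1) := by
  have h : Tendsto (fun i : ℕ => (1 : ℝ) / ((i : ℝ) + 2)) atTop (𝓝 0) :=
    tendsto_const_nhds.div_atTop (tendsto_natCast_atTop_atTop.atTop_add tendsto_const_nhds)
  have h1 := (tendsto_const_nhds (x := (1 : ℝ))).sub h
  rwa [sub_zero] at h1

lemma summable_sq (x : lp (fun _ : ℕ => ℝ) 2) : Summable fun i => x i ^ 2 := by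
  simpa [sq] using lp.summable_inner (𝕜 := ℝ) x x

lemma norm_sq_eq_tsum (x : lp (fun _ : ℕ => ℝ) 2) : ‖x‖ ^ 2 = ∑' i, x i ^ 2 := by
  rw [← real_inner_self_eq_norm_sq, lp.inner_eq_tsum]
  simp [sq]

lemma norm_sq_eq_add_tsum (x : lp (fun _ : ℕ => ℝ) 2) :
    ‖x‖ ^ 2 = x 0 ^ 2 + ∑' i, x (i + 1) ^ 2 := by
  rw [norm_sq_eq_tsum, (summable_sq x).tsum_eq_zero_add]

lemma summable_tail_sq (x : lp (fun _ : ℕ => ℝ) 2) : Summable fun i => x (i + 1) ^ 2 :=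
  (summable_nat_add_iff 1).2 (summable_sq x)

lemma summable_coeff_sq (x : lp (fun _ : ℕ => ℝ) 2) :
    Summable fun i => coeff i ^ 2 * x (i + 1) ^ 2 :=
  (summable_tail_sq x).of_nonneg_of_le (fun i => by positivity)
    fun i => mul_le_of_le_one_left (sq_nonneg _) (coeff_sq_lt_one i).le

/-- The coordinates of index at least one, rescaled so that the ellipsoid becomes a sphere. -/
noncomputable def scaledTail (x : lp (fun _ : ℕ => ℝ) 2) : lp (fun _ : ℕ => ℝ) 2 :=
  ⟨fun i => coeff i * x (i + 1), memℓp_gen (by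
    simpa [mul_pow] using summable_coeff_sq x)⟩

lemma scaledTail_apply (x : lp (fun _ : ℕ => ℝ) 2) (i : ℕ) :
    scaledTail x i = coeff i * x (i + 1) := rfl

lemma norm_scaledTail_sq (x : lp (fun _ : ℕ => ℝ) 2) :
    ‖scaledTail x‖ ^ 2 = ∑' i, coeff i ^ 2 * x (i + 1) ^ 2 := by
  simp only [norm_sq_eq_tsum, scaledTail_apply, mul_pow]

lemma scaledTail_sub (x y : lp (fun _ : ℕ => ℝ) 2) :
    scaledTail (x - y) = scaledTail x - scaledTail y := by
  ext i
  simp [scaledTail_apply, mul_sub]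

/-- Rescaling is a contraction, with a definite gain in each of the coordinates. -/
lemma scaledTail_gain (x : lp (fun _ : ℕ => ℝ) 2) (k : ℕ) :
    x 0 ^ 2 + ‖scaledTail x‖ ^ 2 + (1 - coeff k ^ 2) * x (k + 1) ^ 2 ≤ ‖x‖ ^ 2 := by
  have hs : Summable fun i => (1 - coeff i ^ 2) * x (i + 1) ^ 2 := by
    simpa [sub_mul] using (summable_tail_sq x).sub (summable_coeff_sq x)
  have h1 := hs.le_tsum k
    fun i _ => mul_nonneg (sub_nonneg.2 (coeff_sq_lt_one i).le) (sq_nonneg _)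
  have h2 : ∑' i, (1 - coeff i ^ 2) * x (i + 1) ^ 2
      = ∑' i, x (i + 1) ^ 2 - ∑' i, coeff i ^ 2 * x (i + 1) ^ 2 := by
    rw [← (summable_tail_sq x).tsum_sub (summable_coeff_sq x)]
    simp [sub_mul]
  rw [norm_sq_eq_add_tsum x, norm_scaledTail_sq]
  linarith

/-- Grossman's ellipsoid. -/
def ellipsoid : Set (lp (fun _ : ℕ => ℝ) 2) :=
  {x | x 0 ^ 2 + ∑' i : ℕ, coeff i ^ 2 * x (i + 1) ^ 2 = 1}

lemma mem_ellipsoid_iff {x : lp (fun _ : ℕ => ℝ) 2} :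
    x ∈ ellipsoid ↔ x 0 ^ 2 + ‖scaledTail x‖ ^ 2 = 1 := by
  rw [norm_scaledTail_sq]; rfl

lemma exists_tail_ne_zero {x : lp (fun _ : ℕ => ℝ) 2} (hx : x ∈ ellipsoid) (h0 : x 0 = 0) :
    ∃ k, x (k + 1) ≠ 0 := by
  by_contra! h
  have : x 0 ^ 2 + ∑' i : ℕ, coeff i ^ 2 * x (i + 1) ^ 2 = 1 := hx
  simp [h0, h] at this

/-- Chords of the ellipsoid are bounded below by the spherical chord of the polar angles and the
gain in one coordinate. -/
lemma chord_lower_bound {x y : lp (fun _ : ℕ => ℝ) 2} (hx : x ∈ ellipsoid) (hy : y ∈ ellipsoid)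
    (k : ℕ) :
    (2 * Real.sin ((Real.arccos (x 0) - Real.arccos (y 0)) / 2)) ^ 2
      + (1 - coeff k ^ 2) * (x (k + 1) - y (k + 1)) ^ 2 ≤ ‖x - y‖ ^ 2 := by
  rw [mem_ellipsoid_iff] at hx hy
  have h := scaledTail_gain (x - y) k
  rw [scaledTail_sub] at h
  have hR : (‖scaledTail x‖ - ‖scaledTail y‖) ^ 2 ≤ ‖scaledTail x - scaledTail y‖ ^ 2 :=
    sq_le_sq.2 (by simpa using abs_norm_sub_norm_le (scaledTail x) (scaledTail y))
  have hsin : ∀ z : lp (fun _ : ℕ => ℝ) 2, z 0 ^ 2 + ‖scaledTail z‖ ^ 2 = 1 →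
      Real.cos (Real.arccos (z 0)) = z 0 ∧ Real.sin (Real.arccos (z 0)) = ‖scaledTail z‖ := by
    intro z hz
    refine ⟨Real.cos_arccos ?_ ?_, ?_⟩
    · nlinarith [sq_nonneg ‖scaledTail z‖]
    · nlinarith [sq_nonneg ‖scaledTail z‖]
    · rw [Real.sin_arccos, show 1 - z 0 ^ 2 = ‖scaledTail z‖ ^ 2 by linarith,
        Real.sqrt_sq (norm_nonneg _)]
  obtain ⟨hcx, hsx⟩ := hsin x hx
  obtain ⟨hcy, hsy⟩ := hsin y hy
  have hhalf : (2 * Real.sin ((Real.arccos (x 0) - Real.arccos (y 0)) / 2)) ^ 2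
      = 2 - 2 * (x 0 * y 0 + ‖scaledTail x‖ * ‖scaledTail y‖) := by
    have h2 := Real.cos_sub (Real.arccos (x 0)) (Real.arccos (y 0))
    rw [hcx, hsx, hcy, hsy] at h2
    rw [mul_pow, Real.sin_sq_eq_half_sub, mul_div_cancel₀ _ two_ne_zero, h2]
    ring
  simp only [lp.coeFn_sub, Pi.sub_apply] at h
  nlinarith

lemma abs_le_two_sin_half {ε u : ℝ} (hε : ε ≤ 1) (hu : |u| ≤ 2 * ε) :
    (1 - ε) * |u| ≤ |2 * Real.sin (u / 2)| := by
  wlog h : 0 ≤ u generalizing u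
  · have := this (u := -u) (by simpa using hu) (by linarith)
    simpa [neg_div] using this
  rcases h.eq_or_lt with rfl | h
  · simp
  rw [abs_of_pos h] at *
  have h1 := Real.sin_gt_sub_cube (x := u / 2) (by linarith)
  have h2 : (u / 2) ^ 3 ≤ (u / 2) * ε := by
    nlinarith [mul_pos h h]
  calc (1 - ε) * u ≤ 2 * Real.sin (u / 2) := by nlinarith
    _ ≤ _ := le_abs_self _

/-- A real function whose local oscillation is controlled, up to an arbitrarily small error, by
that of a path has its increments bounded by the length of the path. -/
lemma ofReal_sub_le_eVariationOn {E : Type*} [PseudoMetricSpace E] {γ : ℝ → E} {g : ℝ → ℝ}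
    {a b : ℝ} (hab : a ≤ b)
    (h : ∀ ε ∈ Ioo (0 : ℝ) 1, ∃ δ > 0, ∀ s ∈ Icc a b, ∀ t ∈ Icc a b, dist s t < δ →
      (1 - ε) * |g s - g t| ≤ dist (γ s) (γ t)) :
    ENNReal.ofReal (g b - g a) ≤ eVariationOn γ (Icc a b) := by
  have key : ∀ ε ∈ Ioo (0 : ℝ) 1,
      ENNReal.ofReal ((1 - ε) * (g b - g a)) ≤ eVariationOn γ (Icc a b) := by
    intro ε hε
    obtain ⟨δ, hδ, H⟩ := h ε hε
    obtain ⟨n, hn⟩ := exists_nat_gt ((b - a) / δ)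
    have hn0 : (0 : ℝ) < n := (div_nonneg (sub_nonneg.2 hab) hδ.le).trans_lt hn
    set u : ℕ → ℝ := fun i => a + (b - a) * (i / n) with hu
    have hmono : Monotone u := by
      intro i j hij
      have : (i : ℝ) / n ≤ j / n := by gcongr
      have := mul_le_mul_of_nonneg_left this (sub_nonneg.2 hab)
      simp only [hu]; linarith
    have hu0 : u 0 = a := by simp [hu]
    have hun : u n = b := by simp [hu, hn0.ne']
    have hmem : ∀ i ≤ n, u i ∈ Icc a b := fun i hi =>
      ⟨hu0 ▸ hmono (Nat.zero_le i), hun ▸ hmono hi⟩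
    have hstep : ∀ i, dist (u (i + 1)) (u i) < δ := by
      intro i
      have : u (i + 1) - u i = (b - a) / n := by simp only [hu]; push_cast; ring
      rw [Real.dist_eq, this, abs_of_nonneg (div_nonneg (sub_nonneg.2 hab) hn0.le),
        div_lt_iff₀ hn0]
      rwa [div_lt_iff₀ hδ, mul_comm] at hn
    refine le_trans ?_ (eVariationOn.sum_le_of_monotoneOn_Iic (f := γ) (n := n) (u := u)
      (hmono.monotoneOn _) hmem)
    have hsum : (1 - ε) * (g b - g a)
        ≤ ∑ i ∈ Finset.range n, dist (γ (u (i + 1))) (γ (u i)) := by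
      have htel := Finset.sum_range_sub (fun i => g (u i)) n
      rw [hu0, hun] at htel
      rw [← htel, Finset.mul_sum]
      refine Finset.sum_le_sum fun i hi => ?_
      have hi := Finset.mem_range.1 hi
      refine le_trans ?_ (H _ (hmem _ hi) _ (hmem _ hi.le) (hstep i))
      exact mul_le_mul_of_nonneg_left (le_abs_self _) (by linarith [hε.2])
    refine (ENNReal.ofReal_le_ofReal hsum).trans ?_
    rw [ENNReal.ofReal_sum_of_nonneg fun _ _ => dist_nonneg]
    simp [edist_dist]
  have hlim : Tendsto (fun ε : ℝ => ENNReal.ofReal ((1 - ε) * (g b - g a))) (𝓝[>] 0)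
      (𝓝 (ENNReal.ofReal (g b - g a))) := by
    have : Continuous fun ε : ℝ => ENNReal.ofReal ((1 - ε) * (g b - g a)) :=
      ENNReal.continuous_ofReal.comp (by fun_prop)
    simpa using (this.tendsto 0).mono_left nhdsWithin_le_nhds
  exact le_of_tendsto hlim (by
    filter_upwards [Ioo_mem_nhdsGT (zero_lt_one' ℝ)] with ε hε using key ε hε)

lemma continuous_apply (i : ℕ) : Continuous fun x : lp (fun _ : ℕ => ℝ) 2 => x i :=
  (continuous_pi_iff.1 (lp.uniformContinuous_coe.continuous) i)

/-- Length bound on the ellipsoid by a calibration mixing polar angle and one coordinate. -/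
lemma calibration_le_eVariationOn {γ : ℝ → lp (fun _ : ℕ => ℝ) 2} {r s : ℝ} (hrs : r ≤ s)
    (hc : ContinuousOn γ (Icc r s)) (hM : ∀ t ∈ Icc r s, γ t ∈ ellipsoid) (k : ℕ) {a b : ℝ}
    (hab : a ^ 2 + b ^ 2 = 1) :
    ENNReal.ofReal
      ((a * Real.arccos (γ s 0) + b * (√(1 - coeff k ^ 2) * γ s (k + 1)))
        - (a * Real.arccos (γ r 0) + b * (√(1 - coeff k ^ 2) * γ r (k + 1))))
      ≤ eVariationOn γ (Icc r s) := by
  refine ofReal_sub_le_eVariationOn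
    (g := fun t => a * Real.arccos (γ t 0) + b * (√(1 - coeff k ^ 2) * γ t (k + 1))) hrs ?_
  intro ε hε
  have hθ : UniformContinuousOn (fun t => Real.arccos (γ t 0)) (Icc r s) :=
    isCompact_Icc.uniformContinuousOn_of_continuous
      (Real.continuous_arccos.comp_continuousOn ((continuous_apply 0).comp_continuousOn hc))
  obtain ⟨δ, hδ, H⟩ := Metric.uniformContinuousOn_iff.1 hθ (2 * ε) (by linarith [hε.1])
  refine ⟨δ, hδ, fun t ht t' ht' htt' => ?_⟩
  have hu := (H t ht t' ht' htt').le
  rw [Real.dist_eq] at hu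
  have hchord := chord_lower_bound (hM t ht) (hM t' ht') k
  have hsin := abs_le_two_sin_half hε.2.le hu
  set u := Real.arccos (γ t 0) - Real.arccos (γ t' 0) with hu_def
  set v := √(1 - coeff k ^ 2) * (γ t (k + 1) - γ t' (k + 1)) with hv_def
  have hv : v ^ 2 = (1 - coeff k ^ 2) * (γ t (k + 1) - γ t' (k + 1)) ^ 2 := by
    rw [hv_def, mul_pow, Real.sq_sqrt (sub_nonneg.2 (coeff_sq_lt_one k).le)]
  have hε0 : 0 ≤ 1 - ε := by linarith [hε.2]
  have hsin2 : (1 - ε) ^ 2 * u ^ 2 ≤ (2 * Real.sin (u / 2)) ^ 2 := by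
    have := pow_le_pow_left₀ (by positivity) hsin 2
    rwa [mul_pow, sq_abs, sq_abs] at this
  have hsplit : a * Real.arccos (γ t 0) + b * (√(1 - coeff k ^ 2) * γ t (k + 1))
      - (a * Real.arccos (γ t' 0) + b * (√(1 - coeff k ^ 2) * γ t' (k + 1)))
      = a * u + b * v := by
    rw [hu_def, hv_def]; ring
  have hcs : (a * u + b * v) ^ 2 ≤ u ^ 2 + v ^ 2 := by
    have : u ^ 2 + v ^ 2 = (a ^ 2 + b ^ 2) * (u ^ 2 + v ^ 2) := by rw [hab, one_mul]
    nlinarith [sq_nonneg (a * v - b * u)]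
  have hε1 : (1 - ε) ^ 2 ≤ 1 := pow_le_one₀ hε0 (by linarith [hε.1])
  rw [hsplit, dist_eq_norm]
  refine abs_le_of_sq_le_sq' ?_ (norm_nonneg _) |>.2
  rw [mul_pow, sq_abs]
  calc (1 - ε) ^ 2 * (a * u + b * v) ^ 2 ≤ (1 - ε) ^ 2 * (u ^ 2 + v ^ 2) := by gcongr
    _ ≤ (1 - ε) ^ 2 * u ^ 2 + v ^ 2 := by nlinarith [sq_nonneg v]
    _ ≤ ‖γ t - γ t'‖ ^ 2 := by rw [hv]; linarith

/-- Every path in the ellipsoid joining the poles is longer than a half circle. -/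
theorem pi_lt_eVariationOn {γ : ℝ → lp (fun _ : ℕ => ℝ) 2} (hc : ContinuousOn γ (Icc 0 1))
    (hM : ∀ t ∈ Icc (0 : ℝ) 1, γ t ∈ ellipsoid) (h0 : γ 0 = lp.single 2 0 (1 : ℝ))
    (h1 : γ 1 = -lp.single 2 0 (1 : ℝ)) :
    ENNReal.ofReal Real.pi < eVariationOn γ (Icc 0 1) := by
  obtain ⟨t, ht, ht0⟩ : ∃ t ∈ Icc (0 : ℝ) 1, γ t 0 = 0 := by
    refine intermediate_value_Icc' zero_le_one
      ((continuous_apply 0).comp_continuousOn hc) ?_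
    simp [h0, h1]
  obtain ⟨k, hk⟩ := exists_tail_ne_zero (hM t ht) ht0
  have hL : Icc 0 t ⊆ Icc (0 : ℝ) 1 := Icc_subset_Icc_right ht.2
  have hR : Icc t 1 ⊆ Icc (0 : ℝ) 1 := Icc_subset_Icc_left ht.1
  set m := √(1 - coeff k ^ 2) * γ t (k + 1) with hm
  have hm0 : m ≠ 0 := mul_ne_zero (Real.sqrt_pos.2 (sub_pos.2 (coeff_sq_lt_one k))).ne' hk
  set ρ := √((Real.pi / 2) ^ 2 + m ^ 2) with hρ
  have hρ2 : ρ ^ 2 = (Real.pi / 2) ^ 2 + m ^ 2 := Real.sq_sqrt (by positivity)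
  have hρpi : Real.pi / 2 < ρ := by
    refine Real.lt_sqrt_of_sq_lt ?_
    have : 0 < m ^ 2 := by positivity
    linarith
  have hρ0 : 0 < ρ := Real.pi_div_two_pos.trans hρpi
  have hleft := calibration_le_eVariationOn ht.1 (hc.mono hL) (fun s hs => hM s (hL hs)) k
    (a := Real.pi / 2 / ρ) (b := m / ρ) (by
      rw [div_pow _ ρ, div_pow m, ← add_div, ← hρ2, div_self (by positivity)])
  have hright := calibration_le_eVariationOn ht.2 (hc.mono hR) (fun s hs => hM s (hR hs)) k
    (a := 1) (b := 0) (by norm_num)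
  have hval : Real.pi / 2 / ρ * (Real.pi / 2) + m / ρ * m = ρ := by
    field_simp
    linarith
  have hp0 : γ 0 0 = 1 := by simp [h0]
  have hpk : γ 0 (k + 1) = 0 := by simp [h0]
  have hq0 : γ 1 0 = -1 := by simp [h1]
  rw [ht0, hp0, hpk, ← hm, Real.arccos_zero, Real.arccos_one, hval] at hleft
  rw [ht0, hq0, Real.arccos_zero, Real.arccos_neg_one] at hright
  have hadd := eVariationOn.Icc_add_Icc γ (s := univ) ht.1 ht.2 (mem_univ t)
  simp only [univ_inter] at hadd
  rw [← hadd]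
  calc ENNReal.ofReal Real.pi < ENNReal.ofReal (ρ + Real.pi / 2) :=
        (ENNReal.ofReal_lt_ofReal_iff (by positivity)).2 (by linarith)
    _ = ENNReal.ofReal ρ + ENNReal.ofReal (Real.pi / 2) :=
        ENNReal.ofReal_add hρ0.le Real.pi_div_two_pos.le
    _ ≤ _ := add_le_add (by simpa using hleft)
        (hright.trans' (ENNReal.ofReal_le_ofReal (by linarith)))

/-- The half ellipse from `e₀` to `-e₀` in the plane spanned by `e₀` and `e_{n+1}`. -/
noncomputable def halfEllipse (n : ℕ) (t : ℝ) : lp (fun _ : ℕ => ℝ) 2 :=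
  lp.single 2 0 (Real.cos (Real.pi * t)) + lp.single 2 (n + 1) (Real.sin (Real.pi * t) / coeff n)

lemma halfEllipse_zero (n : ℕ) : halfEllipse n 0 = lp.single 2 0 (1 : ℝ) := by
  simp [halfEllipse]

lemma halfEllipse_one (n : ℕ) : halfEllipse n 1 = -lp.single 2 0 (1 : ℝ) := by
  simp [halfEllipse]

lemma halfEllipse_mem (n : ℕ) (t : ℝ) : halfEllipse n t ∈ ellipsoid := by
  have h0 : halfEllipse n t 0 = Real.cos (Real.pi * t) := by simp [halfEllipse]
  have hs : ∀ i, halfEllipse n t (i + 1) =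
      if i = n then Real.sin (Real.pi * t) / coeff n else 0 := by
    intro i
    simp [halfEllipse, Pi.single_apply]
  change halfEllipse n t 0 ^ 2 + ∑' i : ℕ, coeff i ^ 2 * halfEllipse n t (i + 1) ^ 2 = 1
  rw [tsum_eq_single n (fun i hi => by simp [hs, hi]), h0, hs, if_pos rfl, ← mul_pow,
    mul_div_cancel₀ _ (coeff_pos n).ne', Real.cos_sq_add_sin_sq]

lemma norm_halfEllipse_sub_le (n : ℕ) (s t : ℝ) :
    ‖halfEllipse n s - halfEllipse n t‖ ≤ Real.pi / coeff n * |s - t| := by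
  have hc := coeff_pos n
  set A := Real.pi * s with hA
  set B := Real.pi * t with hB
  have hsq : ‖halfEllipse n s - halfEllipse n t‖ ^ 2
      = (Real.cos A - Real.cos B) ^ 2 + ((Real.sin A - Real.sin B) / coeff n) ^ 2 := by
    rw [norm_sq_eq_add_tsum, tsum_eq_single n]
    · simp [halfEllipse, ← hA, ← hB, sub_div]
    · intro i hi
      simp [halfEllipse, hi]
  have h1 : 1 ≤ (1 / coeff n) ^ 2 := one_le_pow₀ ((one_le_div hc).2 (coeff_lt_one n).le)
  have h2 : (Real.cos A - Real.cos B) ^ 2 + (Real.sin A - Real.sin B) ^ 2 ≤ (A - B) ^ 2 := by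
    have := Real.one_sub_sq_div_two_le_cos (x := A - B)
    rw [Real.cos_sub] at this
    nlinarith [Real.sin_sq_add_cos_sq A, Real.sin_sq_add_cos_sq B]
  refine abs_le_of_sq_le_sq' ?_ (by positivity) |>.2
  calc ‖halfEllipse n s - halfEllipse n t‖ ^ 2
      ≤ (1 / coeff n) ^ 2 * ((Real.cos A - Real.cos B) ^ 2 + (Real.sin A - Real.sin B) ^ 2) := by
        rw [hsq, div_eq_mul_one_div (Real.sin A - Real.sin B), mul_pow]
        nlinarith [sq_nonneg (Real.cos A - Real.cos B)]
    _ ≤ (1 / coeff n) ^ 2 * (A - B) ^ 2 := by gcongr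
    _ = (Real.pi / coeff n * |s - t|) ^ 2 := by
        rw [mul_pow _ |s - t|, sq_abs, hA, hB]; ring

lemma lipschitzWith_halfEllipse (n : ℕ) :
    LipschitzWith (Real.toNNReal (Real.pi / coeff n)) (halfEllipse n) := by
  refine LipschitzWith.of_dist_le_mul fun s t => ?_
  rw [Real.coe_toNNReal _ (div_nonneg Real.pi_pos.le (coeff_pos n).le), dist_eq_norm,
    Real.dist_eq]
  exact norm_halfEllipse_sub_le n s t

lemma eVariationOn_halfEllipse_le (n : ℕ) :
    eVariationOn (halfEllipse n) (Icc 0 1) ≤ ENNReal.ofReal (Real.pi / coeff n) := by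
  have hid : eVariationOn (id : ℝ → ℝ) (Icc 0 1) ≤ 1 := by
    simp
  calc eVariationOn (halfEllipse n) (Icc 0 1)
      ≤ ENNReal.ofReal (Real.pi / coeff n) * eVariationOn (id : ℝ → ℝ) (Icc 0 1) :=
        ((lipschitzWith_halfEllipse n).lipschitzOnWith (s := univ)).comp_eVariationOn_le
          (mapsTo_univ _ _)
    _ ≤ ENNReal.ofReal (Real.pi / coeff n) := mul_le_of_le_one_right' hid

lemma tendsto_ofReal_pi_div_coeff :
    Tendsto (fun n => ENNReal.ofReal (Real.pi / coeff n)) atTop (𝓝 (ENNReal.ofReal Real.pi)) := by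
  have := (tendsto_const_nhds (x := Real.pi)).div tendsto_coeff one_ne_zero
  rw [div_one] at this
  exact ENNReal.tendsto_ofReal this

end Grossman

/-- Grossman's ellipsoid `M = {x ∈ ℓ² : x₀² + Σ_{i≥1} (1 - 1/(i+1))² xᵢ² = 1}`: every
continuous path in `M` from `e₀` to `-e₀` has length strictly greater than `π`, yet the
infimum of the lengths of such paths equals `π`; hence no path realizes the intrinsic
distance between `e₀` and `-e₀` (there is no minimal geodesic). -/
theorem grossman_ellipsoid_no_minimal_geodesic
    (M : Set (lp (fun _ : ℕ => ℝ) 2))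
    (hM : M = {x : lp (fun _ : ℕ => ℝ) 2 |
      ((x : ∀ _ : ℕ, ℝ) 0) ^ 2
        + ∑' i : ℕ, (1 - 1 / ((i : ℝ) + 2)) ^ 2 * ((x : ∀ _ : ℕ, ℝ) (i + 1)) ^ 2 = 1})
    (p q : lp (fun _ : ℕ => ℝ) 2)
    (hp : p = lp.single 2 0 (1 : ℝ)) (hq : q = -lp.single 2 0 (1 : ℝ)) :
    (∀ γ : ℝ → lp (fun _ : ℕ => ℝ) 2,
        ContinuousOn γ (Set.Icc 0 1) → (∀ t ∈ Set.Icc (0:ℝ) 1, γ t ∈ M) →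
        γ 0 = p → γ 1 = q →
        ENNReal.ofReal Real.pi < eVariationOn γ (Set.Icc 0 1)) ∧
      sInf {L : ℝ≥0∞ | ∃ γ : ℝ → lp (fun _ : ℕ => ℝ) 2,
          ContinuousOn γ (Set.Icc 0 1) ∧ (∀ t ∈ Set.Icc (0:ℝ) 1, γ t ∈ M) ∧
          γ 0 = p ∧ γ 1 = q ∧ eVariationOn γ (Set.Icc 0 1) = L}
        = ENNReal.ofReal Real.pi := by
  have hM' : M = Grossman.ellipsoid := hM
  subst hM' hp hq
  refine ⟨fun γ hc hγ h0 h1 => Grossman.pi_lt_eVariationOn hc hγ h0 h1, le_antisymm ?_ ?_⟩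
  · refine ge_of_tendsto' Grossman.tendsto_ofReal_pi_div_coeff fun n => ?_
    refine sInf_le_of_le ?_ (Grossman.eVariationOn_halfEllipse_le n)
    exact ⟨Grossman.halfEllipse n,
      (Grossman.lipschitzWith_halfEllipse n).continuous.continuousOn,
      fun t _ => Grossman.halfEllipse_mem n t, Grossman.halfEllipse_zero n,
      Grossman.halfEllipse_one n, rfl⟩
  · refine le_sInf ?_
    rintro L ⟨γ, hc, hγ, h0, h1, rfl⟩
    exact (Grossman.pi_lt_eVariationOn hc hγ h0 h1).le
end

section
/- In ℓ²(ℕ,ℝ), let M = { x : x₀² + x₁² + Σ_{n≥2} (1 − 1/(n+1))⁴·x_n² = 1 } and let F : ℓ² → ℓ² be the linear map with F(x)₀ = x₀, F(x)₁ = x₁ and F(x)_n = −x_n for all n ≥ 2. Then F is a surjective linear isometry of ℓ² with F(M) = M, and the fixed-point set of F in M is exactly the circle { cos t · e₀ + sin t · e₁ : t ∈ ℝ }. -/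
theorem exists_cos_sin_eq_of_sq_add_sq_eq_one {a b : ℝ} (h : a ^ 2 + b ^ 2 = 1) :
    ∃ t : ℝ, Real.cos t = a ∧ Real.sin t = b := by
  have norm_eq : ‖(⟨a, b⟩ : ℂ)‖ = 1 := by
    rw [Complex.norm_eq_sqrt_sq_add_sq, h, Real.sqrt_one]
  refine ⟨Complex.arg ⟨a, b⟩, ?_, ?_⟩
  · simpa [norm_eq] using Complex.norm_mul_cos_arg ⟨a, b⟩
  · simpa [norm_eq] using Complex.norm_mul_sin_arg ⟨a, b⟩

theorem lp_smul_single_add_smul_single_apply (a b : ℝ) (n : ℕ) :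
    ((a • lp.single 2 0 (1 : ℝ) + b • lp.single 2 1 (1 : ℝ) : lp (fun _ : ℕ => ℝ) 2) :
      ∀ _ : ℕ, ℝ) n = if n = 0 then a else if n = 1 then b else 0 := by
  change a * (lp.single 2 0 (1 : ℝ) : lp (fun _ : ℕ => ℝ) 2) n
    + b * (lp.single 2 1 (1 : ℝ) : lp (fun _ : ℕ => ℝ) 2) n = _
  rw [lp.single_apply, lp.single_apply]
  obtain _ | _ | n := n <;> simp

/-- On Grossman's ellipsoid `M = {x ∈ ℓ² : x₀² + x₁² + Σ_{n≥2} (1 - 1/(n+1))⁴ xₙ² = 1}`,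
the linear map `F` fixing the first two coordinates and changing the sign of all the
others is a surjective linear isometry of `ℓ²` preserving `M`, whose fixed-point set in
`M` is exactly the circle `{cos t · e₀ + sin t · e₁ : t ∈ ℝ}`. -/
theorem grossman_ellipsoid_geodesic_circle
    (M : Set (lp (fun _ : ℕ => ℝ) 2))
    (hM : M = {x : lp (fun _ : ℕ => ℝ) 2 |
      ((x : ∀ _ : ℕ, ℝ) 0) ^ 2 + ((x : ∀ _ : ℕ, ℝ) 1) ^ 2
        + ∑' n : ℕ, (1 - 1 / ((n : ℝ) + 3)) ^ 4 * ((x : ∀ _ : ℕ, ℝ) (n + 2)) ^ 2 = 1})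
    (F : lp (fun _ : ℕ => ℝ) 2 →ₗ[ℝ] lp (fun _ : ℕ => ℝ) 2)
    (hF0 : ∀ x : lp (fun _ : ℕ => ℝ) 2, (F x : ∀ _ : ℕ, ℝ) 0 = (x : ∀ _ : ℕ, ℝ) 0)
    (hF1 : ∀ x : lp (fun _ : ℕ => ℝ) 2, (F x : ∀ _ : ℕ, ℝ) 1 = (x : ∀ _ : ℕ, ℝ) 1)
    (hFn : ∀ (x : lp (fun _ : ℕ => ℝ) 2) (n : ℕ),
      (F x : ∀ _ : ℕ, ℝ) (n + 2) = -((x : ∀ _ : ℕ, ℝ) (n + 2))) :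
    Isometry F ∧ Function.Surjective F ∧ F '' M = M ∧
      {x : lp (fun _ : ℕ => ℝ) 2 | x ∈ M ∧ F x = x}
        = {x : lp (fun _ : ℕ => ℝ) 2 | ∃ t : ℝ,
            x = Real.cos t • lp.single 2 0 (1 : ℝ)
              + Real.sin t • lp.single 2 1 (1 : ℝ)} := by
  have abs_coord : ∀ x n, |(F x : ∀ _ : ℕ, ℝ) n| = |(x : ∀ _ : ℕ, ℝ) n| := by
    rintro x (_ | _ | n)
    · rw [hF0]
    · rw [hF1]
    · rw [hFn, abs_neg]
  have involutive : Function.Involutive F := by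
    intro x
    ext n
    obtain _ | _ | n := n
    · rw [hF0, hF0]
    · rw [hF1, hF1]
    · rw [hFn, hFn, neg_neg]
  have mem_iff : ∀ x, F x ∈ M ↔ x ∈ M := by
    intro x
    simp only [hM, Set.mem_ofPred_eq, hF0, hF1, hFn, neg_sq]
  refine ⟨?_, involutive.surjective, ?_, ?_⟩
  · refine AddMonoidHomClass.isometry_of_norm F fun x => ?_
    simp only [lp.norm_eq_tsum_rpow (by norm_num : 0 < (2 : ENNReal).toReal), Real.norm_eq_abs,
      abs_coord]
  · ext y
    refine ⟨?_, fun hy => ⟨F y, (mem_iff y).2 hy, involutive y⟩⟩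
    rintro ⟨x, hx, rfl⟩
    exact (mem_iff x).2 hx
  · ext x
    simp only [Set.mem_ofPred_eq]
    constructor
    · rintro ⟨hx, hfix⟩
      have tail_zero : ∀ n, (x : ∀ _ : ℕ, ℝ) (n + 2) = 0 := by
        intro n
        have h := hFn x n
        rw [hfix] at h
        linarith
      simp only [hM, Set.mem_ofPred_eq, tail_zero] at hx
      obtain ⟨t, hcos, hsin⟩ := exists_cos_sin_eq_of_sq_add_sq_eq_one
        (by simpa using hx : (x : ∀ _ : ℕ, ℝ) 0 ^ 2 + (x : ∀ _ : ℕ, ℝ) 1 ^ 2 = 1)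
      refine ⟨t, ?_⟩
      ext n
      obtain _ | _ | n := n
      · rw [lp_smul_single_add_smul_single_apply]
        simp [hcos]
      · rw [lp_smul_single_add_smul_single_apply]
        simp [hsin]
      · rw [lp_smul_single_add_smul_single_apply]
        simp [tail_zero]
    · rintro ⟨t, rfl⟩
      constructor
      · simp only [hM, Set.mem_ofPred_eq, lp_smul_single_add_smul_single_apply]
        simp
      · ext n
        obtain _ | _ | n := n
        · rw [hF0]
        · rw [hF1]
        · rw [hFn]
          simp only [lp_smul_single_add_smul_single_apply]
          simp
end
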